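/- (John–Nirenberg-type inequality.) Let μ be a locally finite Borel measure on ℝ^d, let 𝒟 be a finite collection of dyadic cubes, and let {λ_Q}_{Q∈𝒟} be nonnegative real numbers. Then for each 1 < p < ∞, sup_{R∈𝒟} μ(R)^{-1} ‖Σ_{Q∈𝒟, Q⊆R} λ_Q 1_Q‖_{L^1(μ)} and sup_{R∈𝒟} μ(R)^{-1/p} ‖Σ_{Q∈𝒟, Q⊆R} λ_Q 1_Q‖_{L^p(μ)} are comparable, with comparability constants depending only on p. -/

import Mathlib

open MeasureTheory ENNReal
open scoped Classical

/-- A dyadic cube `2^{-k}([0,1)^d + j)` in `ℝ^d`, encoded by its scale `k` and position `j`. -/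
structure DCube (d : ℕ) where
  k : ℤ
  j : Fin d → ℤ
deriving DecidableEq

namespace DCube
variable {d : ℕ}

/-- The dyadic cube as a subset of `ℝ^d`. -/
def toSet (Q : DCube d) : Set (Fin d → ℝ) :=
  {x | ∀ i, (2:ℝ) ^ (-Q.k) * Q.j i ≤ x i ∧ x i < (2:ℝ) ^ (-Q.k) * (Q.j i + 1)}

/-- The dyadic parent of a dyadic cube. -/
def parent (Q : DCube d) : DCube d := ⟨Q.k - 1, fun i => Int.fdiv (Q.j i) 2⟩

end DCube

/-- The `μ`-average `⟨f⟩^μ_Q` of a vector-valued function over a dyadic cube. -/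
noncomputable def cubeAvg {d : ℕ} {E : Type*} [NormedAddCommGroup E] [NormedSpace ℝ E]
    (μ : Measure (Fin d → ℝ)) (Q : DCube d) (f : (Fin d → ℝ) → E) : E :=
  (μ Q.toSet).toReal⁻¹ • ∫ x in Q.toSet, f x ∂μ

/-- The function `Σ_{Q ∈ 𝒟, Q ⊆ R} λ_Q 1_Q`. -/
noncomputable def cumFn {d : ℕ} (𝒟 : Finset (DCube d)) (lam : DCube d → ℝ) (R : DCube d)
    (x : Fin d → ℝ) : ℝ :=
  ∑ Q ∈ 𝒟.filter (fun Q => Q.toSet ⊆ R.toSet), Q.toSet.indicator (fun _ => lam Q) x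

namespace DCube
variable {d : ℕ}

lemma toSet_eq_pi (Q : DCube d) :
    Q.toSet = Set.univ.pi fun i =>
      Set.Ico ((2 : ℝ) ^ (-Q.k) * Q.j i) ((2 : ℝ) ^ (-Q.k) * (Q.j i + 1)) := by
  ext x
  simp [toSet]

lemma measurableSet_toSet (Q : DCube d) : MeasurableSet Q.toSet := by
  rw [toSet_eq_pi]
  exact MeasurableSet.univ_pi fun _ => measurableSet_Ico

lemma measure_toSet_lt_top (μ : Measure (Fin d → ℝ)) [IsLocallyFiniteMeasure μ] (Q : DCube d) :
    μ Q.toSet < ⊤ := by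
  rw [toSet_eq_pi]
  exact (Bornology.IsBounded.pi fun _ => Metric.isBounded_Ico _ _).measure_lt_top

/-- A dyadic cube meeting a dyadic cube of at least its size is contained in it. -/
lemma toSet_subset_of_mem {Q R : DCube d} (hk : R.k ≤ Q.k) {x : Fin d → ℝ}
    (hQ : x ∈ Q.toSet) (hR : x ∈ R.toSet) : Q.toSet ⊆ R.toSet := by
  obtain ⟨m, hm⟩ := Int.le.dest hk
  have hpos : (0 : ℝ) < 2 ^ (-Q.k) := by positivity
  have hscale : (2 : ℝ) ^ (-R.k) = 2 ^ (-Q.k) * 2 ^ m := by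
    rw [← zpow_natCast, ← zpow_add₀ two_ne_zero]
    congr 1
    omega
  intro y hy i
  obtain ⟨hQ₁, hQ₂⟩ := hQ i
  obtain ⟨hR₁, hR₂⟩ := hR i
  obtain ⟨hy₁, hy₂⟩ := hy i
  rw [hscale, mul_assoc] at hR₁ hR₂ ⊢
  rw [mul_assoc]
  have h₁ : (2 : ℤ) ^ m * R.j i < Q.j i + 1 := by
    exact_mod_cast lt_of_mul_lt_mul_left (hR₁.trans_lt hQ₂) hpos.le
  have h₂ : Q.j i < (2 : ℤ) ^ m * (R.j i + 1) := by
    exact_mod_cast lt_of_mul_lt_mul_left (hQ₁.trans_lt hR₂) hpos.le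
  have h₁' : (2 : ℝ) ^ m * R.j i ≤ Q.j i := by exact_mod_cast Int.lt_add_one_iff.mp h₁
  have h₂' : (Q.j i : ℝ) + 1 ≤ 2 ^ m * (R.j i + 1) := by exact_mod_cast Int.add_one_le_iff.mpr h₂
  exact ⟨(mul_le_mul_of_nonneg_left h₁' hpos.le).trans hy₁,
    hy₂.trans_le (mul_le_mul_of_nonneg_left h₂' hpos.le)⟩

lemma toSet_subset_or_subset {Q R : DCube d} {x : Fin d → ℝ}
    (hQ : x ∈ Q.toSet) (hR : x ∈ R.toSet) : Q.toSet ⊆ R.toSet ∨ R.toSet ⊆ Q.toSet :=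
  (le_total R.k Q.k).imp (fun h => toSet_subset_of_mem h hQ hR)
    (fun h => toSet_subset_of_mem h hR hQ)

end DCube

lemma ENNReal.add_pow_succ_le (a l : ℝ≥0∞) (n : ℕ) :
    (a + l) ^ (n + 1) ≤ a ^ (n + 1) + (n + 1) * (l * (a + l) ^ n) := by
  induction n with
  | zero => simp
  | succ n ih =>
    calc (a + l) ^ (n + 1 + 1) = (a + l) * (a + l) ^ (n + 1) := pow_succ' _ _
      _ ≤ (a + l) * (a ^ (n + 1) + (n + 1) * (l * (a + l) ^ n)) := by gcongr
      _ = a ^ (n + 1 + 1) + (l * a ^ (n + 1) + (n + 1) * (l * (a + l) ^ (n + 1))) := by ring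
      _ ≤ a ^ (n + 1 + 1) + (l * (a + l) ^ (n + 1) + (n + 1) * (l * (a + l) ^ (n + 1))) := by
        gcongr
        exact le_self_add
      _ = _ := by push_cast; ring

/-- Summation by parts over a finite chain. -/
lemma Finset.sum_pow_succ_le_of_chain {ι α : Type*} [PartialOrder α] (f : ι → α) (w : ι → ℝ≥0∞)
    (n : ℕ) (s : Finset ι) (hs : ∀ i ∈ s, ∀ j ∈ s, f i ≤ f j ∨ f j ≤ f i) :
    (∑ i ∈ s, w i) ^ (n + 1) ≤
      (n + 1) * ∑ i ∈ s, w i * (∑ j ∈ s.filter (fun j => f j ≤ f i), w j) ^ n := by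
  induction s using Finset.strongInduction with
  | H s ih =>
    rcases s.eq_empty_or_nonempty with rfl | hne
    · simp
    obtain ⟨m, hm⟩ := s.exists_maximalFor f hne
    have hms : m ∈ s := hm.1
    have htop : s.filter (fun j => f j ≤ f m) = s := by
      refine Finset.filter_true_of_mem fun i hi => ?_
      rcases hs i hi m hms with h | h
      · exact h
      · exact hm.2 hi h
    have hrest := ih (s.erase m) (Finset.erase_ssubset hms) fun i hi j hj =>
      hs i (Finset.mem_of_mem_erase hi) j (Finset.mem_of_mem_erase hj)
    calc (∑ i ∈ s, w i) ^ (n + 1)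
        = (∑ i ∈ s.erase m, w i + w m) ^ (n + 1) := by rw [Finset.sum_erase_add _ _ hms]
      _ ≤ (∑ i ∈ s.erase m, w i) ^ (n + 1) +
          (n + 1) * (w m * (∑ i ∈ s.erase m, w i + w m) ^ n) := ENNReal.add_pow_succ_le _ _ _
      _ ≤ (n + 1) * (∑ i ∈ s.erase m,
            w i * (∑ j ∈ (s.erase m).filter (fun j => f j ≤ f i), w j) ^ n) +
          (n + 1) * (w m * (∑ i ∈ s, w i) ^ n) := by
        rw [Finset.sum_erase_add _ _ hms]
        gcongr
      _ ≤ (n + 1) * (∑ i ∈ s.erase m, w i * (∑ j ∈ s.filter (fun j => f j ≤ f i), w j) ^ n) +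
          (n + 1) * (w m * (∑ i ∈ s, w i) ^ n) := by
        gcongr
        exact Finset.erase_subset _ _
      _ = _ := by
        rw [← mul_add, ← Finset.sum_erase_add s
          (fun i => w i * (∑ j ∈ s.filter (fun j => f j ≤ f i), w j) ^ n) hms, htop]

section CumFn
variable {d : ℕ} (𝒟 : Finset (DCube d)) (lam : DCube d → ℝ)

/-- The extended nonnegative real version of `cumFn`. -/
noncomputable def cumFnENN (R : DCube d) (x : Fin d → ℝ) : ℝ≥0∞ :=
  ∑ Q ∈ 𝒟.filter (fun Q => Q.toSet ⊆ R.toSet),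
    Q.toSet.indicator (fun _ => ENNReal.ofReal (lam Q)) x

lemma enorm_cumFn (hlam : ∀ Q, 0 ≤ lam Q) (R : DCube d) (x : Fin d → ℝ) :
    ‖cumFn 𝒟 lam R x‖ₑ = cumFnENN 𝒟 lam R x := by
  have hnn : ∀ Q : DCube d, 0 ≤ Q.toSet.indicator (fun _ => lam Q) x := fun Q =>
    Set.indicator_nonneg (fun _ _ => hlam Q) x
  rw [cumFn, Real.enorm_of_nonneg (Finset.sum_nonneg fun Q _ => hnn Q),
    ENNReal.ofReal_sum_of_nonneg fun Q _ => hnn Q, cumFnENN]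
  refine Finset.sum_congr rfl fun Q _ => ?_
  by_cases h : x ∈ Q.toSet <;> simp [h]

lemma measurable_cumFn (R : DCube d) : Measurable (cumFn 𝒟 lam R) := by
  unfold cumFn
  exact Finset.measurable_fun_sum _ fun Q _ => measurable_const.indicator Q.measurableSet_toSet

lemma measurable_cumFnENN (R : DCube d) : Measurable (cumFnENN 𝒟 lam R) := by
  unfold cumFnENN
  exact Finset.measurable_fun_sum _ fun Q _ => measurable_const.indicator Q.measurableSet_toSet

lemma indicator_cumFn (R : DCube d) : R.toSet.indicator (cumFn 𝒟 lam R) = cumFn 𝒟 lam R := by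
  refine Set.indicator_eq_self.mpr fun x hx => ?_
  by_contra hxR
  refine hx (Finset.sum_eq_zero fun Q hQ => Set.indicator_of_notMem ?_ _)
  exact fun hxQ => hxR ((Finset.mem_filter.mp hQ).2 hxQ)

lemma eLpNorm_cumFn_restrict (μ : Measure (Fin d → ℝ)) (R : DCube d) (q : ℝ≥0∞) :
    eLpNorm (cumFn 𝒟 lam R) q (μ.restrict R.toSet) = eLpNorm (cumFn 𝒟 lam R) q μ := by
  rw [← eLpNorm_indicator_eq_eLpNorm_restrict R.measurableSet_toSet, indicator_cumFn]

lemma cumFnENN_pow_succ_le (n : ℕ) (R : DCube d) (x : Fin d → ℝ) :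
    cumFnENN 𝒟 lam R x ^ (n + 1) ≤
      (n + 1) * ∑ Q ∈ 𝒟.filter (fun Q => Q.toSet ⊆ R.toSet),
        ENNReal.ofReal (lam Q) * Q.toSet.indicator (fun x => cumFnENN 𝒟 lam Q x ^ n) x := by
  have hsum (S : DCube d) : cumFnENN 𝒟 lam S x =
      ∑ Q ∈ (𝒟.filter (fun Q => Q.toSet ⊆ S.toSet)).filter (fun Q => x ∈ Q.toSet),
        ENNReal.ofReal (lam Q) := by
    simp only [cumFnENN, Finset.sum_filter _ _, Set.indicator_apply]
  rw [hsum R]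
  refine (Finset.sum_pow_succ_le_of_chain DCube.toSet _ n _ fun Q hQ S hS =>
    DCube.toSet_subset_or_subset (Finset.mem_filter.mp hQ).2 (Finset.mem_filter.mp hS).2).trans ?_
  rw [Finset.sum_filter]
  gcongr with Q hQ
  split_ifs with hx
  · rw [Set.indicator_of_mem hx, hsum Q]
    gcongr
    intro S
    simp only [Finset.mem_filter]
    tauto
  · exact zero_le

variable {𝒟 lam}

lemma lintegral_cumFnENN_pow_le {μ : Measure (Fin d → ℝ)} {A : ℝ≥0∞}
    (hA : ∀ R ∈ 𝒟, ∫⁻ x in R.toSet, cumFnENN 𝒟 lam R x ∂μ ≤ A * μ R.toSet)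
    (n : ℕ) {R : DCube d} (hR : R ∈ 𝒟) :
    ∫⁻ x in R.toSet, cumFnENN 𝒟 lam R x ^ n ∂μ ≤ n.factorial * A ^ n * μ R.toSet := by
  induction n generalizing R with
  | zero => simp
  | succ n ih =>
    set s := 𝒟.filter (fun Q => Q.toSet ⊆ R.toSet)
    have hmeas (Q : DCube d) :
        Measurable (Q.toSet.indicator fun x => cumFnENN 𝒟 lam Q x ^ n) :=
      ((measurable_cumFnENN 𝒟 lam Q).pow_const n).indicator Q.measurableSet_toSet
    have hone : ∑ Q ∈ s, ENNReal.ofReal (lam Q) * μ Q.toSet =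
        ∫⁻ x in R.toSet, cumFnENN 𝒟 lam R x ∂μ := by
      unfold cumFnENN
      rw [lintegral_finsetSum _ fun Q _ => measurable_const.indicator Q.measurableSet_toSet]
      refine Finset.sum_congr rfl fun Q hQ => ?_
      rw [lintegral_indicator_const Q.measurableSet_toSet,
        Measure.restrict_apply Q.measurableSet_toSet,
        Set.inter_eq_left.mpr (Finset.mem_filter.mp hQ).2]
    calc ∫⁻ x in R.toSet, cumFnENN 𝒟 lam R x ^ (n + 1) ∂μ
        ≤ ∫⁻ x in R.toSet, (n + 1) * ∑ Q ∈ s, ENNReal.ofReal (lam Q) *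
            Q.toSet.indicator (fun x => cumFnENN 𝒟 lam Q x ^ n) x ∂μ :=
          lintegral_mono fun x => cumFnENN_pow_succ_le 𝒟 lam n R x
      _ = (n + 1) * ∑ Q ∈ s, ENNReal.ofReal (lam Q) *
            ∫⁻ x in Q.toSet, cumFnENN 𝒟 lam Q x ^ n ∂μ := by
          rw [lintegral_const_mul _
            (Finset.measurable_fun_sum _ fun Q _ => (hmeas Q).const_mul _),
            lintegral_finsetSum _ fun Q _ => (hmeas Q).const_mul _]
          congr 1
          refine Finset.sum_congr rfl fun Q hQ => ?_
          rw [lintegral_const_mul _ (hmeas Q), lintegral_indicator Q.measurableSet_toSet,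
            Measure.restrict_restrict Q.measurableSet_toSet,
            Set.inter_eq_left.mpr (Finset.mem_filter.mp hQ).2]
      _ ≤ (n + 1) * ∑ Q ∈ s, ENNReal.ofReal (lam Q) * (n.factorial * A ^ n * μ Q.toSet) := by
          gcongr with Q hQ
          exact ih (Finset.mem_filter.mp hQ).1
      _ = (n + 1) * (n.factorial * A ^ n) * ∑ Q ∈ s, ENNReal.ofReal (lam Q) * μ Q.toSet := by
          rw [mul_assoc, Finset.mul_sum _ _ ((n.factorial : ℝ≥0∞) * A ^ n)]
          congr 1
          exact Finset.sum_congr rfl fun Q _ => by ring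
      _ ≤ (n + 1) * (n.factorial * A ^ n) * (A * μ R.toSet) := by
          rw [hone]
          gcongr
          exact hA R hR
      _ = _ := by
          rw [Nat.factorial_succ]
          push_cast
          ring

end CumFn

/-- Normalized `L^q` norms over a cube are monotone in `q`. -/
lemma rpow_mul_eLpNorm_cumFn_mono {d : ℕ} {μ : Measure (Fin d → ℝ)} {𝒟 : Finset (DCube d)}
    {lam : DCube d → ℝ} {R : DCube d} (h0 : μ R.toSet ≠ 0) (htop : μ R.toSet ≠ ⊤)
    {a b : ℝ} (ha : 0 < a) (hab : a ≤ b) :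
    μ R.toSet ^ (-(1 / a)) * eLpNorm (cumFn 𝒟 lam R) (ENNReal.ofReal a) μ ≤
      μ R.toSet ^ (-(1 / b)) * eLpNorm (cumFn 𝒟 lam R) (ENNReal.ofReal b) μ := by
  have h := eLpNorm_le_eLpNorm_mul_rpow_measure_univ (μ := μ.restrict R.toSet)
    (ENNReal.ofReal_le_ofReal hab) (measurable_cumFn 𝒟 lam R).aestronglyMeasurable
  rw [eLpNorm_cumFn_restrict, eLpNorm_cumFn_restrict, Measure.restrict_apply_univ,
    ENNReal.toReal_ofReal ha.le, ENNReal.toReal_ofReal (ha.le.trans hab)] at h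
  calc μ R.toSet ^ (-(1 / a)) * eLpNorm (cumFn 𝒟 lam R) (ENNReal.ofReal a) μ
      ≤ μ R.toSet ^ (-(1 / a)) * (eLpNorm (cumFn 𝒟 lam R) (ENNReal.ofReal b) μ *
          μ R.toSet ^ (1 / a - 1 / b)) := by gcongr
    _ = μ R.toSet ^ (-(1 / a) + (1 / a - 1 / b)) *
          eLpNorm (cumFn 𝒟 lam R) (ENNReal.ofReal b) μ := by
        rw [ENNReal.rpow_add _ _ h0 htop]
        ring
    _ = _ := by
        congr 2
        ring

/-- **A John–Nirenberg-type inequality.**  Let `μ` be a locally finite Borel measure on `ℝ^d`,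
let `𝒟` be a finite collection of dyadic cubes, and let `{λ_Q}_{Q ∈ 𝒟}` be nonnegative real
numbers.  Then for each `1 < p < ∞`, the quantities
`sup_{R ∈ 𝒟, μ(R) > 0} μ(R)⁻¹ ‖Σ_{Q ⊆ R} λ_Q 1_Q‖_{L^1(μ)}` and
`sup_{R ∈ 𝒟, μ(R) > 0} μ(R)^{-1/p} ‖Σ_{Q ⊆ R} λ_Q 1_Q‖_{L^p(μ)}` are comparable, with
comparability constants depending only on `p`. -/
theorem john_nirenberg_type (p : ℝ) (hp : 1 < p) :
    ∃ K : ℝ≥0∞, K ≠ ⊤ ∧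
      ∀ (d : ℕ) (μ : Measure (Fin d → ℝ)), IsLocallyFiniteMeasure μ →
        ∀ (𝒟 : Finset (DCube d)) (lam : DCube d → ℝ), (∀ Q, 0 ≤ lam Q) →
          (⨆ R ∈ 𝒟.filter (fun R => 0 < μ R.toSet),
              (μ R.toSet)⁻¹ * eLpNorm (cumFn 𝒟 lam R) 1 μ)
            ≤ K * (⨆ R ∈ 𝒟.filter (fun R => 0 < μ R.toSet),
                (μ R.toSet) ^ (-(1 / p)) * eLpNorm (cumFn 𝒟 lam R) (ENNReal.ofReal p) μ) ∧
          (⨆ R ∈ 𝒟.filter (fun R => 0 < μ R.toSet),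
              (μ R.toSet) ^ (-(1 / p)) * eLpNorm (cumFn 𝒟 lam R) (ENNReal.ofReal p) μ)
            ≤ K * (⨆ R ∈ 𝒟.filter (fun R => 0 < μ R.toSet),
                (μ R.toSet)⁻¹ * eLpNorm (cumFn 𝒟 lam R) 1 μ) := by
  have hn1 : 1 ≤ ⌈p⌉₊ := Nat.one_le_iff_ne_zero.mpr (Nat.ceil_pos.mpr (by linarith)).ne'
  have hK1 : (1 : ℝ≥0∞) ≤ (⌈p⌉₊.factorial : ℝ≥0∞) := by
    exact_mod_cast Nat.one_le_iff_ne_zero.mpr (Nat.factorial_ne_zero _)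
  refine ⟨⌈p⌉₊.factorial, ENNReal.natCast_ne_top _, fun d μ hμ 𝒟 lam hlam => ⟨?_, ?_⟩⟩
  · refine le_trans ?_ (le_mul_of_one_le_left' hK1)
    refine iSup₂_mono fun R hR => ?_
    have h := rpow_mul_eLpNorm_cumFn_mono (𝒟 := 𝒟) (lam := lam)
      (Finset.mem_filter.mp hR).2.ne' (R.measure_toSet_lt_top μ).ne one_pos hp.le
    simpa [ENNReal.rpow_neg_one] using h
  · set A := ⨆ R ∈ 𝒟.filter (fun R => 0 < μ R.toSet),
      (μ R.toSet)⁻¹ * eLpNorm (cumFn 𝒟 lam R) 1 μ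
    have hA : ∀ R ∈ 𝒟, ∫⁻ x in R.toSet, cumFnENN 𝒟 lam R x ∂μ ≤ A * μ R.toSet := by
      intro R hR
      rcases eq_or_ne (μ R.toSet) 0 with h0 | h0
      · rw [setLIntegral_measure_zero _ _ h0]
        exact zero_le
      · have h : (μ R.toSet)⁻¹ * eLpNorm (cumFn 𝒟 lam R) 1 μ ≤ A :=
          le_iSup₂_of_le R (Finset.mem_filter.mpr ⟨hR, pos_iff_ne_zero.mpr h0⟩) le_rfl
        rw [← ENNReal.div_eq_inv_mul,
          ENNReal.div_le_iff h0 (R.measure_toSet_lt_top μ).ne] at h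
        rw [← eLpNorm_cumFn_restrict, eLpNorm_one_eq_lintegral_enorm] at h
        simpa only [enorm_cumFn 𝒟 lam hlam] using h
    refine iSup₂_le fun R hR => ?_
    obtain ⟨hRD, hpos⟩ := Finset.mem_filter.mp hR
    have htop := (R.measure_toSet_lt_top μ).ne
    have hn0 : (0 : ℝ) < ⌈p⌉₊ := by exact_mod_cast hn1
    refine (rpow_mul_eLpNorm_cumFn_mono hpos.ne' htop (by linarith) (Nat.le_ceil p)).trans ?_
    have hnorm : eLpNorm (cumFn 𝒟 lam R) (ENNReal.ofReal ⌈p⌉₊) μ ≤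
        (⌈p⌉₊.factorial * A ^ ⌈p⌉₊ * μ R.toSet) ^ (1 / (⌈p⌉₊ : ℝ)) := by
      rw [← eLpNorm_cumFn_restrict, eLpNorm_eq_lintegral_rpow_enorm_toReal
        (by simpa using hn0) ENNReal.ofReal_ne_top, ENNReal.toReal_ofReal hn0.le]
      simp only [enorm_cumFn 𝒟 lam hlam, ENNReal.rpow_natCast]
      gcongr
      exact lintegral_cumFnENN_pow_le hA _ hRD
    calc μ R.toSet ^ (-(1 / (⌈p⌉₊ : ℝ))) * eLpNorm (cumFn 𝒟 lam R) (ENNReal.ofReal ⌈p⌉₊) μ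
        ≤ μ R.toSet ^ (-(1 / (⌈p⌉₊ : ℝ))) *
            (⌈p⌉₊.factorial * A ^ ⌈p⌉₊ * μ R.toSet) ^ (1 / (⌈p⌉₊ : ℝ)) := by gcongr
      _ = (⌈p⌉₊.factorial : ℝ≥0∞) ^ (1 / (⌈p⌉₊ : ℝ)) * A := by
          rw [ENNReal.mul_rpow_of_nonneg _ _ (by positivity),
            ENNReal.mul_rpow_of_nonneg _ _ (by positivity), one_div,
            ENNReal.pow_rpow_inv_natCast (by omega), mul_comm, mul_assoc,
            ← ENNReal.rpow_add _ _ hpos.ne' htop, add_neg_cancel, ENNReal.rpow_zero, mul_one]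
      _ ≤ (⌈p⌉₊.factorial : ℝ≥0∞) ^ (1 : ℝ) * A := by
          gcongr
          exact (div_le_one hn0).mpr (by exact_mod_cast hn1)
      _ = ⌈p⌉₊.factorial * A := by rw [ENNReal.rpow_one]
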